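/- Let S_1, …, S_n be nonempty finite sets, let x_q : S_q → ℝ be weight functions with x_q(j) ≥ 0 and Σ_{j ∈ S_q} x_q(j) = 1 for each q, and let u_q : S_q → ℝ be arbitrary functions. Then Σ_{q=1}^n Σ_{j ∈ S_q} x_q(j) · ∏_{r < q} ( Σ_{k ∈ S_r : u_r(k) < u_q(j)} x_r(k) ) · ∏_{r > q} ( Σ_{k ∈ S_r : u_r(k) ≤ u_q(j)} x_r(k) ) = 1. That is, the probabilities P computed across all iterations of the Max-Polymatrix expectation algorithm's inner loop (the probability that opponent q plays j and that j yields the first-attained maximum utility) sum to one. -/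

import Mathlib

open scoped Classical

/-- In a nonempty finite linear order, exactly one index attains the maximum of `f` for the
first time. -/
theorem existsUnique_first_max {ι : Type*} [LinearOrder ι] [Fintype ι] [Nonempty ι]
    (f : ι → ℝ) : ∃! q, (∀ r < q, f r < f q) ∧ ∀ r > q, f r ≤ f q := by
  obtain ⟨m, hm⟩ := Finite.exists_max f
  have hne : (Finset.univ.filter fun q => f m ≤ f q).Nonempty := ⟨m, by simp⟩
  obtain ⟨q, hq, hmin⟩ := Finset.exists_min_image _ id hne
  simp only [Finset.mem_filter, Finset.mem_univ, true_and, id] at hq hmin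
  refine ⟨q, ⟨fun r hr => ?_, fun r _ => (hm r).trans hq⟩, fun p hp => ?_⟩
  · by_contra! h
    exact (hmin r (hq.trans h)).not_gt hr
  · rcases lt_trichotomy p q with h | h | h
    · by_contra
      exact (hmin p (hq.trans (hp.2 q h))).not_gt h
    · exact h
    · exact absurd (hp.1 q h) ((hm p).trans hq).not_gt

/-- Splitting a product over `Fin n` at an index. -/
theorem prod_univ_eq_mul_prod_Iio_mul_prod_Ioi {n : ℕ} (q : Fin n) (g : Fin n → ℝ) :
    ∏ r, g r = g q * (∏ r ∈ Finset.Iio q, g r) * ∏ r ∈ Finset.Ioi q, g r := by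
  have h : (Finset.univ : Finset (Fin n)) = insert q (Finset.Iio q ∪ Finset.Ioi q) := by
    ext r
    rcases lt_trichotomy r q with h | h | h <;> simp [h]
  have hd : Disjoint (Finset.Iio q) (Finset.Ioi q) :=
    Finset.disjoint_left.2 fun r h₁ h₂ => (Finset.mem_Iio.1 h₁).not_gt (Finset.mem_Ioi.1 h₂)
  rw [h, Finset.prod_insert (by simp), Finset.prod_union hd, mul_assoc]

/-- The term indexed by `(q, j)` is the probability that `q` plays `j` and that `j` yields the
first-attained maximum utility. -/
theorem first_max_term_eq_sum {n : ℕ} {S : Fin n → Type*} [∀ q, Fintype (S q)]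
    (x u : ∀ q, S q → ℝ) (q : Fin n) (j : S q) :
    x q j
        * (∏ r ∈ Finset.Iio q, ∑ k ∈ Finset.univ.filter (fun k : S r => u r k < u q j), x r k)
        * (∏ r ∈ Finset.Ioi q, ∑ k ∈ Finset.univ.filter (fun k : S r => u r k ≤ u q j), x r k)
    = ∑ s : ∀ r, S r, if s q = j ∧ (∀ r < q, u r (s r) < u q (s q)) ∧
        ∀ r > q, u r (s r) ≤ u q (s q) then ∏ r, x r (s r) else 0 := by
  let A : ∀ r, Finset (S r) := Function.update
    (fun r => if r < q then Finset.univ.filter (fun k : S r => u r k < u q j)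
      else Finset.univ.filter (fun k : S r => u r k ≤ u q j)) q {j}
  have hAq : A q = {j} := Function.update_self ..
  have hAl : ∀ r < q, A r = Finset.univ.filter (fun k : S r => u r k < u q j) := fun r hr => by
    simp [A, hr.ne, hr]
  have hAg : ∀ r > q, A r = Finset.univ.filter (fun k : S r => u r k ≤ u q j) := fun r hr => by
    simp [A, hr.ne', hr.not_gt]
  have hmem : ∀ s : ∀ r, S r, s ∈ Fintype.piFinset A ↔
      s q = j ∧ (∀ r < q, u r (s r) < u q (s q)) ∧ ∀ r > q, u r (s r) ≤ u q (s q) := by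
    intro s
    rw [Fintype.mem_piFinset]
    constructor
    · intro h
      have hj : s q = j := by simpa [hAq] using h q
      refine ⟨hj, fun r hr => ?_, fun r hr => ?_⟩
      · simpa [hAl r hr, hj] using h r
      · simpa [hAg r hr, hj] using h r
    · rintro ⟨rfl, hl, hg⟩ r
      rcases lt_trichotomy r q with h | rfl | h
      · simpa [hAl r h] using hl r h
      · simp [hAq]
      · simpa [hAg r h] using hg r h
  have key := Finset.prod_univ_sum A x
  rw [prod_univ_eq_mul_prod_Iio_mul_prod_Ioi q, hAq, Finset.sum_singleton,
    Finset.prod_congr rfl fun r hr => by rw [hAl r (Finset.mem_Iio.1 hr)],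
    Finset.prod_congr (s₁ := Finset.Ioi q) rfl fun r hr => by
      rw [hAg r (Finset.mem_Ioi.1 hr)]] at key
  rw [key, ← Finset.sum_filter]
  exact Finset.sum_congr (by ext s; simp only [hmem, Finset.mem_filter, Finset.mem_univ,
    true_and]) fun _ _ => rfl

/-- The probabilities computed across the iterations of the Max-Polymatrix expectation
algorithm's inner loop — the probability that opponent `q` plays `j` and that `j` yields
the first-attained maximum utility — sum to one. -/
theorem stmt_8 (n : ℕ) (hn : 1 ≤ n) (S : Fin n → Type*) [∀ q, Fintype (S q)]
    [∀ q, Nonempty (S q)]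
    (x : ∀ q, S q → ℝ) (hx : ∀ q j, 0 ≤ x q j) (hx1 : ∀ q, ∑ j : S q, x q j = 1)
    (u : ∀ q, S q → ℝ) :
    (∑ q : Fin n, ∑ j : S q, x q j
        * (∏ r ∈ Finset.Iio q, ∑ k ∈ Finset.univ.filter (fun k : S r => u r k < u q j), x r k)
        * (∏ r ∈ Finset.Ioi q, ∑ k ∈ Finset.univ.filter (fun k : S r => u r k ≤ u q j), x r k))
    = 1 := by
  have : Nonempty (Fin n) := ⟨⟨0, hn⟩⟩
  have htotal : ∑ s : ∀ r, S r, ∏ r, x r (s r) = 1 := by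
    rw [← Fintype.piFinset_univ, ← Finset.prod_univ_sum]
    simp [hx1]
  simp only [first_max_term_eq_sum]
  rw [← htotal, Finset.sum_congr rfl fun q _ => Finset.sum_comm, Finset.sum_comm]
  refine Finset.sum_congr rfl fun s _ => ?_
  obtain ⟨q, hq, huniq⟩ := existsUnique_first_max fun r => u r (s r)
  rw [Finset.sum_eq_single q, Finset.sum_eq_single (s q)]
  · exact if_pos ⟨rfl, hq⟩
  · exact fun j _ hj => if_neg fun h => hj h.1.symm
  · simp
  · exact fun p _ hp => Finset.sum_eq_zero fun j _ => if_neg fun h => hp (huniq p h.2)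
  · simp
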